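/- Let H be a subgraph of a simple graph G on {1,…,n}. Then the Hilbert series of E_H divides that of E_G with nonnegative quotient: there exist natural numbers c₀, c₁, c₂, … such that for every d ≥ 0, dim_ℚ E_G^d = Σ_{k=0}^{d} c_k · dim_ℚ E_H^{d−k}. -/

import Mathlib

open scoped TensorProduct

namespace FK

/-- Defining relations of the Fomin–Kirillov algebra `E n`, with generators indexed by
ordered pairs `(i, j)`; we also impose `x_{ii} = 0` and the antisymmetry `x_{ji} = -x_{ij}`,
so that the generators of the algebra are the `x_{ij}` for `i < j`. -/
inductive Rel (n : ℕ) : FreeAlgebra ℚ (Fin n × Fin n) → FreeAlgebra ℚ (Fin n × Fin n) → Prop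
  | diag (i : Fin n) : Rel n (FreeAlgebra.ι ℚ (i, i)) 0
  | antisymm (i j : Fin n) (hij : i ≠ j) :
      Rel n (FreeAlgebra.ι ℚ (j, i)) (-FreeAlgebra.ι ℚ (i, j))
  | square (i j : Fin n) (hij : i ≠ j) :
      Rel n (FreeAlgebra.ι ℚ (i, j) * FreeAlgebra.ι ℚ (i, j)) 0
  | comm (i j k l : Fin n) (h : List.Nodup [i, j, k, l]) :
      Rel n (FreeAlgebra.ι ℚ (i, j) * FreeAlgebra.ι ℚ (k, l))
        (FreeAlgebra.ι ℚ (k, l) * FreeAlgebra.ι ℚ (i, j))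
  | cyclic (i j k : Fin n) (h : List.Nodup [i, j, k]) :
      Rel n (FreeAlgebra.ι ℚ (i, j) * FreeAlgebra.ι ℚ (j, k)
        + FreeAlgebra.ι ℚ (j, k) * FreeAlgebra.ι ℚ (k, i)
        + FreeAlgebra.ι ℚ (k, i) * FreeAlgebra.ι ℚ (i, j)) 0

/-- The Fomin–Kirillov algebra `E n`. -/
abbrev E (n : ℕ) : Type := RingQuot (Rel n)

/-- The generator `x_{ij}` of `E n`. -/
noncomputable def x (n : ℕ) (i j : Fin n) : E n :=
  RingQuot.mkAlgHom ℚ (Rel n) (FreeAlgebra.ι ℚ (i, j))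

/-- The product of generators `x_{i₁j₁} ⋯ x_{i_d j_d}` given by a list of pairs. -/
noncomputable def word (n : ℕ) (l : List (Fin n × Fin n)) : E n :=
  (l.map fun p => x n p.1 p.2).prod

/-- The degree-`d` component of `E n`: the span of products of `d` generators. -/
def degSpan (n : ℕ) (d : ℕ) : Submodule ℚ (E n) :=
  Submodule.span ℚ {y | ∃ l : List (Fin n × Fin n),
    (∀ p ∈ l, p.1 ≠ p.2) ∧ l.length = d ∧ y = word n l}

/-- The Fomin–Kirillov algebra of a graph `G`: the subalgebra of `E n` generated by the
`x_{ij}` with `{i,j}` an edge of `G`. -/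
def EG (n : ℕ) (G : SimpleGraph (Fin n)) : Subalgebra ℚ (E n) :=
  Algebra.adjoin ℚ {y | ∃ i j : Fin n, G.Adj i j ∧ y = x n i j}

/-- The degree-`d` component `E_G^d = E_G ∩ E_n^d`. -/
def EGdeg (n : ℕ) (G : SimpleGraph (Fin n)) (d : ℕ) : Submodule ℚ (E n) :=
  (EG n G).toSubmodule ⊓ degSpan n d

/-- The positive-degree part `E_G⁺` of `E_G`. -/
def EGplus (n : ℕ) (G : SimpleGraph (Fin n)) : Submodule ℚ (E n) :=
  ⨆ d : ℕ, ⨆ _ : 1 ≤ d, EGdeg n G d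



theorem x_diag (n : ℕ) (i : Fin n) : x n i i = 0 := by
  simpa [x] using RingQuot.mkAlgHom_rel ℚ (Rel.diag i)

theorem x_antisymm (n : ℕ) (i j : Fin n) : x n j i = - x n i j := by
  by_cases h : i = j
  · subst h; simp [x_diag]
  · simpa [x] using RingQuot.mkAlgHom_rel ℚ (Rel.antisymm i j h)

theorem neg_eq_smul (n : ℕ) (u : E n) : -u = (-1 : ℚ) • u := by
  rw [Algebra.smul_def, map_neg, map_one]
  exact (neg_one_mul u).symm

theorem x_antisymm' (n : ℕ) (i j : Fin n) : x n j i = (-1 : ℚ) • x n i j := by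
  rw [x_antisymm, neg_eq_smul]

theorem x_square (n : ℕ) (i j : Fin n) : x n i j * x n i j = 0 := by
  by_cases h : i = j
  · subst h; simp [x_diag]
  · simpa [x] using RingQuot.mkAlgHom_rel ℚ (Rel.square i j h)

theorem x_comm (n : ℕ) (i j k l : Fin n) (h : List.Nodup [i, j, k, l]) :
    x n i j * x n k l = x n k l * x n i j := by
  simpa [x] using RingQuot.mkAlgHom_rel ℚ (Rel.comm i j k l h)

theorem x_cyclic (n : ℕ) (i j k : Fin n) (h : List.Nodup [i, j, k]) :
    x n i j * x n j k + x n j k * x n k i + x n k i * x n i j = 0 := by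
  simpa [x] using RingQuot.mkAlgHom_rel ℚ (Rel.cyclic i j k h)

/-- Universal property of `E n`. -/
theorem exists_lift (n : ℕ) {A : Type} [Semiring A] [Algebra ℚ A] (f : Fin n → Fin n → A)
    (hd : ∀ i, f i i = 0) (ha : ∀ i j, i ≠ j → f j i = (-1 : ℚ) • f i j)
    (hs : ∀ i j, i ≠ j → f i j * f i j = 0)
    (hc : ∀ i j k l, List.Nodup [i, j, k, l] → f i j * f k l = f k l * f i j)
    (hy : ∀ i j k, List.Nodup [i, j, k] →
      f i j * f j k + f j k * f k i + f k i * f i j = 0) :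
    ∃ φ : E n →ₐ[ℚ] A, ∀ i j, φ (x n i j) = f i j := by
  refine ⟨RingQuot.liftAlgHom ℚ ⟨FreeAlgebra.lift ℚ (fun p : Fin n × Fin n => f p.1 p.2), ?_⟩, ?_⟩
  · intro a b h
    induction h with
    | diag i => simp [hd]
    | antisymm i j h =>
      rw [← neg_one_smul ℚ (FreeAlgebra.ι ℚ (i, j)), map_smul]
      simpa using ha i j h
    | square i j h => simp [hs i j h]
    | comm i j k l h => simp [hc i j k l h]
    | cyclic i j k h => simp [hy i j k h]
  · intro i j
    simp [x]

theorem hom_ext (n : ℕ) {A : Type} [Ring A] [Algebra ℚ A] (φ ψ : E n →ₐ[ℚ] A)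
    (h : ∀ i j, φ (x n i j) = ψ (x n i j)) : φ = ψ := by
  apply RingQuot.ringQuot_ext'
  apply FreeAlgebra.hom_ext
  funext p
  exact h p.1 p.2

/-- The action of a permutation. -/
theorem exists_perm (n : ℕ) (w : Equiv.Perm (Fin n)) :
    ∃ φ : E n →ₐ[ℚ] E n, ∀ i j, φ (x n i j) = x n (w i) (w j) := by
  apply exists_lift n (fun i j => x n (w i) (w j))
  · intro i; exact x_diag n _
  · intro i j _; exact x_antisymm' n _ _
  · intro i j _; exact x_square n _ _
  · intro i j k l h
    exact x_comm n _ _ _ _ (by simpa using h)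
  · intro i j k h
    exact x_cyclic n _ _ _ (by simpa using h)

noncomputable def act (n : ℕ) (w : Equiv.Perm (Fin n)) : E n →ₐ[ℚ] E n :=
  (exists_perm n w).choose

theorem act_x (n : ℕ) (w : Equiv.Perm (Fin n)) (i j : Fin n) :
    act n w (x n i j) = x n (w i) (w j) := (exists_perm n w).choose_spec i j

theorem act_mul (n : ℕ) (v w : Equiv.Perm (Fin n)) (u : E n) :
    act n v (act n w u) = act n (v * w) u := by
  have : (act n v).comp (act n w) = act n (v * w) := by
    apply hom_ext
    intro i j
    simp [act_x]
  exact DFunLike.congr_fun this u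

noncomputable instance tensorGroup (n : ℕ) : AddCommGroup (E n ⊗[ℚ] E n) :=
  Module.addCommMonoidToAddCommGroup ℚ

/-- The operator `x_{ij}` acts by on `E ⊗ E` (braided coproduct). -/
noncomputable def T (n : ℕ) (i j : Fin n) : Module.End ℚ (E n ⊗[ℚ] E n) :=
  TensorProduct.map (LinearMap.mulLeft ℚ (x n i j)) LinearMap.id +
  TensorProduct.map (act n (Equiv.swap i j)).toLinearMap (LinearMap.mulLeft ℚ (x n i j))

theorem T_tmul (n : ℕ) (i j : Fin n) (u v : E n) :
    T n i j (u ⊗ₜ v) = (x n i j * u) ⊗ₜ v + act n (Equiv.swap i j) u ⊗ₜ (x n i j * v) := by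
  simp [T]

theorem T_T_tmul (n : ℕ) (i j k l : Fin n) (u v : E n) :
    T n i j (T n k l (u ⊗ₜ v)) = (x n i j * x n k l * u) ⊗ₜ v
      + (x n i j * act n (Equiv.swap k l) u) ⊗ₜ (x n k l * v)
      + (x n (Equiv.swap i j k) (Equiv.swap i j l) * act n (Equiv.swap i j) u) ⊗ₜ (x n i j * v)
      + act n (Equiv.swap i j * Equiv.swap k l) u ⊗ₜ (x n i j * x n k l * v) := by
  simp only [T_tmul, map_add, map_mul, act_x, act_mul, mul_assoc]
  abel

theorem exists_rho (n : ℕ) : ∃ φ : E n →ₐ[ℚ] Module.End ℚ (E n ⊗[ℚ] E n),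
    ∀ i j, φ (x n i j) = T n i j := by
  apply exists_lift n (T n)
  · intro i
    apply TensorProduct.ext'
    intro u v
    simp [T_tmul, x_diag]
  · intro i j _
    apply TensorProduct.ext'
    intro u v
    rw [LinearMap.smul_apply, T_tmul, T_tmul, x_antisymm' n i j, Equiv.swap_comm j i]
    simp only [smul_mul_assoc, ← TensorProduct.smul_tmul', TensorProduct.tmul_smul, smul_add]
  · intro i j _
    apply TensorProduct.ext'
    intro u v
    rw [Module.End.mul_apply, T_T_tmul, x_square, Equiv.swap_apply_left, Equiv.swap_apply_right,
      x_antisymm' n i j]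
    simp only [smul_mul_assoc, ← TensorProduct.smul_tmul', neg_one_smul, zero_mul,
      TensorProduct.zero_tmul, TensorProduct.tmul_zero, LinearMap.zero_apply]
    abel
  · intro i j k l h
    apply TensorProduct.ext'
    intro u v
    have h' : Equiv.swap i j * Equiv.swap k l = Equiv.swap k l * Equiv.swap i j := by
      apply (Equiv.Perm.disjoint_swap_swap h).commute
    have hn : (i ≠ j ∧ i ≠ k ∧ i ≠ l) ∧ (j ≠ k ∧ j ≠ l) ∧ k ≠ l := by
      simp at h; tauto
    obtain ⟨⟨h1, h2, h3⟩, ⟨h4, h5⟩, h6⟩ := hn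
    rw [Module.End.mul_apply, Module.End.mul_apply, T_T_tmul, T_T_tmul, x_comm n i j k l h, h',
      Equiv.swap_apply_of_ne_of_ne h2.symm h4.symm, Equiv.swap_apply_of_ne_of_ne h3.symm h5.symm,
      Equiv.swap_apply_of_ne_of_ne h2 h3, Equiv.swap_apply_of_ne_of_ne h4 h5]
    abel
  · intro i j k h
    have hcyc := x_cyclic n i j k h
    have hn : i ≠ j ∧ i ≠ k ∧ j ≠ k := by
      simp at h; tauto
    obtain ⟨h1, h2, h3⟩ := hn
    have e1 : Equiv.swap j k * Equiv.swap k i = Equiv.swap i j * Equiv.swap j k := by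
      ext a; simp only [Equiv.Perm.mul_apply, Equiv.swap_apply_def]; split_ifs <;> simp_all
    have e2 : Equiv.swap k i * Equiv.swap i j = Equiv.swap i j * Equiv.swap j k := by
      ext a; simp only [Equiv.Perm.mul_apply, Equiv.swap_apply_def]; split_ifs <;> simp_all
    apply TensorProduct.ext'
    intro u v
    simp only [LinearMap.add_apply, Module.End.mul_apply, T_T_tmul, LinearMap.zero_apply, e1, e2,
      Equiv.swap_apply_left, Equiv.swap_apply_right,
      Equiv.swap_apply_of_ne_of_ne h2.symm h3.symm, Equiv.swap_apply_of_ne_of_ne h1 h2,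
      Equiv.swap_apply_of_ne_of_ne h3 h1.symm]
    have c1 : x n k j = (-1 : ℚ) • x n j k := x_antisymm' n _ _
    have c2 : x n i k = (-1 : ℚ) • x n k i := x_antisymm' n _ _
    have c3 : x n j i = (-1 : ℚ) • x n i j := x_antisymm' n _ _
    rw [c1, c2, c3]
    have z1 : (x n i j * x n j k * u) ⊗ₜ[ℚ] v + (x n j k * x n k i * u) ⊗ₜ[ℚ] v
        + (x n k i * x n i j * u) ⊗ₜ[ℚ] v = 0 := by
      rw [← TensorProduct.add_tmul, ← TensorProduct.add_tmul, ← add_mul, ← add_mul, hcyc]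
      simp
    have z2 : ∀ u' : E n, u' ⊗ₜ[ℚ] (x n i j * x n j k * v) + u' ⊗ₜ[ℚ] (x n j k * x n k i * v)
        + u' ⊗ₜ[ℚ] (x n k i * x n i j * v) = 0 := by
      intro u'
      rw [← TensorProduct.tmul_add, ← TensorProduct.tmul_add, ← add_mul, ← add_mul, hcyc]
      simp
    have z2' := z2 (act n (Equiv.swap i j * Equiv.swap j k) u)
    simp only [smul_mul_assoc, ← TensorProduct.smul_tmul', neg_one_smul]
    rw [← add_zero (0 : E n ⊗[ℚ] E n)]
    nth_rewrite 1 [← z1]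
    rw [← z2']
    abel

noncomputable def rho (n : ℕ) : E n →ₐ[ℚ] Module.End ℚ (E n ⊗[ℚ] E n) := (exists_rho n).choose

theorem rho_x (n : ℕ) (i j : Fin n) : rho n (x n i j) = T n i j := (exists_rho n).choose_spec i j

/-- The braided coproduct. -/
noncomputable def Del (n : ℕ) : E n →ₗ[ℚ] E n ⊗[ℚ] E n :=
  (LinearMap.applyₗ (1 ⊗ₜ[ℚ] 1 : E n ⊗[ℚ] E n)).comp (rho n).toLinearMap

theorem Del_one (n : ℕ) : Del n 1 = 1 ⊗ₜ 1 := by simp [Del]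

theorem Del_x_mul (n : ℕ) (i j : Fin n) (a : E n) : Del n (x n i j * a) = T n i j (Del n a) := by
  simp [Del, rho_x]

/-- The grading. -/
theorem exists_grade (n : ℕ) : ∃ φ : E n →ₐ[ℚ] Polynomial (E n),
    ∀ i j, φ (x n i j) = Polynomial.monomial 1 (x n i j) := by
  apply exists_lift n (fun i j => Polynomial.monomial 1 (x n i j))
  · intro i; simp [x_diag]
  · intro i j _; rw [x_antisymm' n i j, Polynomial.smul_monomial]
  · intro i j _; rw [Polynomial.monomial_mul_monomial, x_square]; simp
  · intro i j k l h
    rw [Polynomial.monomial_mul_monomial, Polynomial.monomial_mul_monomial, x_comm n i j k l h]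
  · intro i j k h
    rw [Polynomial.monomial_mul_monomial, Polynomial.monomial_mul_monomial,
      Polynomial.monomial_mul_monomial, ← map_add, ← map_add, x_cyclic n i j k h]
    simp

noncomputable def grade (n : ℕ) : E n →ₐ[ℚ] Polynomial (E n) := (exists_grade n).choose

theorem grade_x (n : ℕ) (i j : Fin n) :
    grade n (x n i j) = Polynomial.monomial 1 (x n i j) := (exists_grade n).choose_spec i j

theorem word_nil (n : ℕ) : word n [] = 1 := by simp [word]

theorem word_cons (n : ℕ) (p : Fin n × Fin n) (l : List (Fin n × Fin n)) :
    word n (p :: l) = x n p.1 p.2 * word n l := by simp [word]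

theorem word_append (n : ℕ) (l m : List (Fin n × Fin n)) :
    word n (l ++ m) = word n l * word n m := by simp [word]

theorem grade_word (n : ℕ) (l : List (Fin n × Fin n)) :
    grade n (word n l) = Polynomial.monomial l.length (word n l) := by
  induction l with
  | nil => simp [word_nil]
  | cons p l ih =>
    rw [word_cons, map_mul, ih, grade_x, Polynomial.monomial_mul_monomial, List.length_cons,
      add_comm]

/-- Projection to degree `d`. -/
noncomputable def proj (n d : ℕ) : E n →ₗ[ℚ] E n where
  toFun a := (grade n a).coeff d
  map_add' a b := by simp
  map_smul' c a := by simp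

theorem proj_word (n d : ℕ) (l : List (Fin n × Fin n)) :
    proj n d (word n l) = if l.length = d then word n l else 0 := by
  change (grade n (word n l)).coeff d = _
  rw [grade_word, Polynomial.coeff_monomial]

/-- Edge words. -/
def GWords (n : ℕ) (G : SimpleGraph (Fin n)) (d : ℕ) : Set (E n) :=
  {y | ∃ l : List (Fin n × Fin n), (∀ p ∈ l, G.Adj p.1 p.2) ∧ l.length = d ∧ y = word n l}

theorem word_mem_EG (n : ℕ) (G : SimpleGraph (Fin n)) (l : List (Fin n × Fin n))
    (h : ∀ p ∈ l, G.Adj p.1 p.2) : word n l ∈ EG n G := by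
  induction l with
  | nil => rw [word_nil]; exact one_mem _
  | cons p l ih =>
    rw [word_cons]
    refine mul_mem (Algebra.subset_adjoin ⟨p.1, p.2, h p (by simp), rfl⟩) (ih ?_)
    intro q hq; exact h q (by simp [hq])

theorem word_mem_EGdeg (n : ℕ) (G : SimpleGraph (Fin n)) (l : List (Fin n × Fin n))
    (h : ∀ p ∈ l, G.Adj p.1 p.2) : word n l ∈ EGdeg n G l.length :=
  ⟨word_mem_EG n G l h, Submodule.subset_span ⟨l, fun p hp => (h p hp).ne, rfl, rfl⟩⟩

/-- `E_G` is spanned by the edge words. -/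
theorem EG_le_span (n : ℕ) (G : SimpleGraph (Fin n)) (a : E n) (ha : a ∈ EG n G) :
    a ∈ Submodule.span ℚ {y | ∃ l : List (Fin n × Fin n),
      (∀ p ∈ l, G.Adj p.1 p.2) ∧ y = word n l} := by
  induction ha using Algebra.adjoin_induction with
  | mem y hy =>
    obtain ⟨i, j, h, rfl⟩ := hy
    exact Submodule.subset_span ⟨[(i, j)], by simpa using h, by simp [word]⟩
  | algebraMap r =>
    rw [Algebra.algebraMap_eq_smul_one]
    exact Submodule.smul_mem _ _ (Submodule.subset_span ⟨[], by simp, by simp [word]⟩)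
  | add y z _ _ hy hz => exact add_mem hy hz
  | mul y z _ _ hy hz =>
    have := Submodule.mul_mem_mul hy hz
    rw [Submodule.span_mul_span] at this
    refine Submodule.span_mono ?_ this
    rintro _ ⟨_, ⟨l, hl, rfl⟩, _, ⟨m, hm, rfl⟩, rfl⟩
    refine ⟨l ++ m, ?_, (word_append n l m).symm⟩
    intro p hp
    rcases List.mem_append.1 hp with h | h
    · exact hl p h
    · exact hm p h

theorem proj_degSpan (n d : ℕ) (a : E n) (ha : a ∈ degSpan n d) : proj n d a = a := by
  induction ha using Submodule.span_induction with
  | mem y hy =>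
    obtain ⟨l, _, hl, rfl⟩ := hy
    rw [proj_word, if_pos hl]
  | zero => simp
  | add y z _ _ hy hz => rw [map_add, hy, hz]
  | smul c y _ hy => rw [map_smul, hy]

theorem EGdeg_eq (n : ℕ) (G : SimpleGraph (Fin n)) (d : ℕ) :
    EGdeg n G d = Submodule.span ℚ (GWords n G d) := by
  apply le_antisymm
  · rintro a ⟨ha, hd⟩
    rw [← proj_degSpan n d a hd]
    have := EG_le_span n G a ha
    clear ha hd
    induction this using Submodule.span_induction with
    | mem y hy =>
      obtain ⟨l, hl, rfl⟩ := hy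
      rw [proj_word]
      split_ifs with h
      · exact Submodule.subset_span ⟨l, hl, h, rfl⟩
      · exact zero_mem _
    | zero => simp
    | add y z _ _ hy hz => rw [map_add]; exact add_mem hy hz
    | smul c y _ hy => rw [map_smul]; exact Submodule.smul_mem _ _ hy
  · rw [Submodule.span_le]
    rintro _ ⟨l, hl, rfl, rfl⟩
    exact word_mem_EGdeg n G l hl

theorem EGdeg_mul_le (n : ℕ) (G : SimpleGraph (Fin n)) (i j : ℕ) :
    EGdeg n G i * EGdeg n G j ≤ EGdeg n G (i + j) := by
  rw [EGdeg_eq, EGdeg_eq, EGdeg_eq, Submodule.span_mul_span]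
  apply Submodule.span_mono
  rintro _ ⟨_, ⟨l, hl, rfl, rfl⟩, _, ⟨m, hm, rfl, rfl⟩, rfl⟩
  refine ⟨l ++ m, ?_, by simp, (word_append n l m).symm⟩
  intro p hp
  rcases List.mem_append.1 hp with h | h
  · exact hl p h
  · exact hm p h

theorem EGdeg_mono (n : ℕ) {H G : SimpleGraph (Fin n)} (h : H ≤ G) (d : ℕ) :
    EGdeg n H d ≤ EGdeg n G d := by
  rw [EGdeg_eq, EGdeg_eq]
  apply Submodule.span_mono
  rintro _ ⟨l, hl, hd, rfl⟩
  exact ⟨l, fun p hp => h (hl p hp), hd, rfl⟩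

instance EGdeg_finite (n : ℕ) (G : SimpleGraph (Fin n)) (d : ℕ) :
    Module.Finite ℚ ↥(EGdeg n G d) := by
  rw [EGdeg_eq]
  apply FiniteDimensional.span_of_finite
  refine ((List.finite_length_eq (Fin n × Fin n) d).image (word n)).subset ?_
  rintro _ ⟨l, _, hd, rfl⟩
  exact ⟨l, hd, rfl⟩

/-- `(B⁺A)_d`. -/
noncomputable def W (n : ℕ) (G H : SimpleGraph (Fin n)) (d : ℕ) : Submodule ℚ (E n) :=
  ⨆ k : ℕ, ⨆ _ : k < d, EGdeg n H (d - k) * EGdeg n G k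

theorem W_le (n : ℕ) {G H : SimpleGraph (Fin n)} (h : H ≤ G) (d : ℕ) :
    W n G H d ≤ EGdeg n G d := by
  refine iSup_le fun k => iSup_le fun hk => ?_
  refine (mul_le_mul_left (EGdeg_mono n h (d - k)) _).trans ((EGdeg_mul_le n G _ _).trans ?_)
  rw [Nat.sub_add_cancel hk.le]

theorem exists_C (n : ℕ) {G H : SimpleGraph (Fin n)} (h : H ≤ G) (d : ℕ) :
    ∃ (C : Submodule ℚ (E n)) (P : E n →ₗ[ℚ] E n), C ≤ EGdeg n G d ∧
      EGdeg n G d ≤ W n G H d ⊔ C ∧ (∀ a ∈ W n G H d, P a = 0) ∧ (∀ a ∈ C, P a = a) := by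
  obtain ⟨W', hW⟩ := Submodule.exists_isCompl (W n G H d)
  refine ⟨W' ⊓ EGdeg n G d, W'.subtype.comp (Submodule.projectionOnto W' _ hW.symm),
    inf_le_right, ?_, ?_, ?_⟩
  · rw [← sup_inf_assoc_of_le _ (W_le n h d), hW.sup_eq_top, top_inf_eq]
  · intro a ha
    simp [ha]
  · intro a ha
    have := Submodule.projectionOnto_apply_left hW.symm ⟨a, ha.1⟩
    simp [this]

/-- `Δ(word) = 1 ⊗ word + lower terms`. -/
theorem Del_word (n : ℕ) (G : SimpleGraph (Fin n)) (l : List (Fin n × Fin n))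
    (hl : ∀ p ∈ l, G.Adj p.1 p.2) :
    ∃ r ∈ Submodule.span ℚ {t | ∃ (u : E n)
      (m : List (Fin n × Fin n)), (∀ p ∈ m, G.Adj p.1 p.2) ∧ m.length < l.length ∧
        t = u ⊗ₜ[ℚ] word n m}, Del n (word n l) = r + 1 ⊗ₜ word n l := by
  induction l with
  | nil => exact ⟨0, zero_mem _, by rw [word_nil, Del_one, zero_add]⟩
  | cons p l ih =>
    have hl' : ∀ q ∈ l, G.Adj q.1 q.2 := fun q hq => hl q (by simp [hq])
    obtain ⟨r, ih, hr⟩ := ih hl'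
    refine ⟨T n p.1 p.2 r + x n p.1 p.2 ⊗ₜ word n l, ?_, ?_⟩
    swap
    · rw [word_cons, Del_x_mul, hr, map_add, T_tmul, map_one, mul_one, add_assoc]
    refine add_mem ?_ (Submodule.subset_span ⟨_, l, hl', by simp, rfl⟩)
    rw [← Submodule.mem_comap]
    refine Submodule.span_le.2 ?_ ih
    rintro _ ⟨u, m, hm, hlen, rfl⟩
    rw [SetLike.mem_coe, Submodule.mem_comap, T_tmul, ← word_cons]
    refine add_mem (Submodule.subset_span ⟨_, m, hm, ?_, rfl⟩)
      (Submodule.subset_span ⟨_, p :: m, ?_, ?_, rfl⟩)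
    · simp; omega
    · intro q hq
      rcases List.mem_cons.1 hq with rfl | h
      · exact hl _ (by simp)
      · exact hm q h
    · simp; omega

/-- `Δ(E_G) ⊆ E ⊗ E_G`. -/
theorem Del_EG (n : ℕ) (G : SimpleGraph (Fin n)) (a : E n) (ha : a ∈ EG n G) :
    Del n a ∈ Submodule.span ℚ {t | ∃ (u : E n)
      (m : List (Fin n × Fin n)), (∀ p ∈ m, G.Adj p.1 p.2) ∧ t = u ⊗ₜ[ℚ] word n m} := by
  rw [← Submodule.mem_comap]
  refine Submodule.span_le.2 ?_ (EG_le_span n G a ha)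
  rintro _ ⟨l, hl, rfl⟩
  rw [SetLike.mem_coe, Submodule.mem_comap]
  obtain ⟨r, hr, e⟩ := Del_word n G l hl
  rw [e]
  refine add_mem (Submodule.span_mono ?_ hr) (Submodule.subset_span ⟨_, l, hl, rfl⟩)
  rintro _ ⟨u, m, hm, _, rfl⟩
  exact ⟨u, m, hm, rfl⟩

section main

variable (n : ℕ) (G H : SimpleGraph (Fin n)) (e : ℕ) (P : E n →ₗ[ℚ] E n)

/-- `D_e = (1 ⊗ P π_e) Δ`. -/
noncomputable def DD : E n →ₗ[ℚ] E n ⊗[ℚ] E n :=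
  (TensorProduct.map LinearMap.id (P.comp (proj n e))).comp (Del n)

theorem DD_x_mul (hP : ∀ a ∈ W n G H e, P a = 0) (i j : Fin n) (hij : H.Adj i j) (a : E n)
    (ha : a ∈ EG n G) :
    DD n e P (x n i j * a) =
      TensorProduct.map (LinearMap.mulLeft ℚ (x n i j)) LinearMap.id (DD n e P a) := by
  simp only [DD, LinearMap.comp_apply, Del_x_mul]
  have := Del_EG n G a ha
  generalize Del n a = t at this
  induction this using Submodule.span_induction with
  | mem t ht =>
    obtain ⟨u, m, hm, rfl⟩ := ht
    have key : P (proj n e (x n i j * word n m)) = 0 := by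
      rw [← word_cons n (i, j) m, proj_word]
      split_ifs with h
      · apply hP
        simp only [List.length_cons] at h
        refine Submodule.mem_iSup_of_mem m.length (Submodule.mem_iSup_of_mem (by omega) ?_)
        rw [word_cons]
        refine Submodule.mul_mem_mul ?_ (word_mem_EGdeg n G m hm)
        have := word_mem_EGdeg n H [(i, j)] (by simpa using hij)
        have h1 : e - m.length = 1 := by omega
        rw [h1]
        simpa [word] using this
      · simp
    rw [T_tmul]
    simp [key]
  | zero => simp
  | add y z _ _ hy hz => simp only [map_add, hy, hz]
  | smul c y _ hy => simp only [map_smul, hy]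

theorem DD_mul (hHG : H ≤ G) (hP : ∀ a ∈ W n G H e, P a = 0) (b : E n) (hb : b ∈ EG n H) (a : E n)
    (ha : a ∈ EG n G) :
    DD n e P (b * a) =
      TensorProduct.map (LinearMap.mulLeft ℚ b) LinearMap.id (DD n e P a) := by
  have := EG_le_span n H b hb
  clear hb
  induction this using Submodule.span_induction with
  | mem y hy =>
    obtain ⟨l, hl, rfl⟩ := hy
    induction l with
    | nil => simp [word_nil]
    | cons p l ih =>
      have hl' : ∀ q ∈ l, H.Adj q.1 q.2 := fun q hq => hl q (by simp [hq])
      rw [word_cons, mul_assoc, DD_x_mul n G H e P hP _ _ (hl p (by simp)), ih hl',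
        LinearMap.mulLeft_mul, ← LinearMap.comp_apply, ← TensorProduct.map_comp]
      · rfl
      · exact mul_mem (word_mem_EG n G l fun p hp => hHG (hl' p hp)) ha
  | zero => simp
  | add y z _ _ hy hz =>
    have : LinearMap.mulLeft ℚ (y + z) = LinearMap.mulLeft ℚ y + LinearMap.mulLeft ℚ z := by
      apply LinearMap.ext; intro t; simp [add_mul]
    rw [add_mul, map_add, hy, hz, this, TensorProduct.map_add_left, LinearMap.add_apply]
  | smul c y _ hy =>
    have : LinearMap.mulLeft ℚ (c • y) = c • LinearMap.mulLeft ℚ y := by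
      apply LinearMap.ext; intro t; simp
    rw [smul_mul_assoc, map_smul, hy, this, TensorProduct.map_smul_left, LinearMap.smul_apply]

theorem DD_low (k : ℕ) (hk : k ≤ e) (a : E n) (ha : a ∈ EGdeg n G k) :
    DD n e P a = 1 ⊗ₜ P (proj n e a) := by
  rw [EGdeg_eq] at ha
  induction ha using Submodule.span_induction with
  | mem y hy =>
    obtain ⟨l, hl, hlen, rfl⟩ := hy
    obtain ⟨r, h, hr⟩ := Del_word n G l hl
    have e1 : TensorProduct.map LinearMap.id (P.comp (proj n e)) r = 0 →
        DD n e P (word n l) = 1 ⊗ₜ P (proj n e (word n l)) := by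
      intro h0
      rw [DD, LinearMap.comp_apply, hr, map_add, h0, zero_add]
      simp
    apply e1
    rw [← LinearMap.mem_ker]
    refine Submodule.span_le.2 ?_ h
    rintro _ ⟨u, m, hm, hlt, rfl⟩
    rw [SetLike.mem_coe, LinearMap.mem_ker, TensorProduct.map_tmul, LinearMap.comp_apply,
      proj_word, if_neg (by omega)]
    simp
  | zero => simp
  | add y z _ _ hy hz => simp only [map_add, hy, hz, TensorProduct.tmul_add]
  | smul c y _ hy => simp only [map_smul, hy, TensorProduct.tmul_smul]

end main

theorem freeS (n : ℕ) (S : Submodule ℚ (E n)) : Module.Free ℚ S := by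
  let _ : AddCommGroup S := Module.addCommMonoidToAddCommGroup ℚ
  exact Module.Free.of_divisionRing _ _

/-- Multiplication `B ⊗ C → E`. -/
noncomputable def mulBC (n : ℕ) (B C : Submodule ℚ (E n)) : B ⊗[ℚ] C →ₗ[ℚ] E n :=
  (LinearMap.mul' ℚ (E n)).comp (TensorProduct.map B.subtype C.subtype)

theorem mulBC_tmul (n : ℕ) (B C : Submodule ℚ (E n)) (b : B) (c : C) :
    mulBC n B C (b ⊗ₜ c) = (b : E n) * (c : E n) := by simp [mulBC]

theorem mulBC_range (n : ℕ) (B C : Submodule ℚ (E n)) :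
    LinearMap.range (mulBC n B C) = B * C := by
  apply le_antisymm
  · rintro _ ⟨t, rfl⟩
    induction t using TensorProduct.induction_on with
    | zero => simp
    | tmul b c => rw [mulBC_tmul]; exact Submodule.mul_mem_mul b.2 c.2
    | add y z hy hz => rw [map_add]; exact add_mem hy hz
  · rw [Submodule.mul_le]
    intro b hb c hc
    exact ⟨⟨b, hb⟩ ⊗ₜ ⟨c, hc⟩, mulBC_tmul _ _ _ _ _⟩

theorem DD_mulBC (n : ℕ) {G H : SimpleGraph (Fin n)} (hHG : H ≤ G) (e : ℕ) (P : E n →ₗ[ℚ] E n)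
    (hP : ∀ a ∈ W n G H e, P a = 0) (i k : ℕ) (hk : k ≤ e) (C : Submodule ℚ (E n))
    (hC : C ≤ EGdeg n G k) (t : ↥(EGdeg n H i) ⊗[ℚ] ↥C) :
    DD n e P (mulBC n _ _ t) =
      TensorProduct.map (EGdeg n H i).subtype ((P.comp (proj n e)).comp C.subtype) t := by
  induction t using TensorProduct.induction_on with
  | zero => simp
  | tmul b c =>
    rw [mulBC_tmul, DD_mul n G H e P hHG hP _ b.2.1 _ (hC c.2).1, DD_low n G e P k hk _ (hC c.2)]
    simp
  | add y z hy hz => rw [map_add, map_add, hy, hz, map_add]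

theorem proj_ne (n : ℕ) (G : SimpleGraph (Fin n)) (k e : ℕ) (h : k ≠ e) (a : E n)
    (ha : a ∈ EGdeg n G k) : proj n e a = 0 := by
  rw [EGdeg_eq] at ha
  rw [← LinearMap.mem_ker]
  refine Submodule.span_le.2 ?_ ha
  rintro _ ⟨l, _, rfl, rfl⟩
  rw [SetLike.mem_coe, LinearMap.mem_ker, proj_word, if_neg h]

theorem decomp (n : ℕ) {G H : SimpleGraph (Fin n)} (hHG : H ≤ G) (C : ℕ → Submodule ℚ (E n))
    (hC : ∀ d, C d ≤ EGdeg n G d) (hC' : ∀ d, EGdeg n G d ≤ W n G H d ⊔ C d) (d : ℕ) :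
    EGdeg n G d = ⨆ k : Fin (d + 1), EGdeg n H (d - k) * C k := by
  apply le_antisymm
  · induction d using Nat.strong_induction_on with
    | _ d ih =>
      refine (hC' d).trans (sup_le ?_ ?_)
      · refine iSup_le fun k => iSup_le fun hk => ?_
        refine (mul_le_mul_right (ih k hk) _).trans ?_
        rw [Submodule.mul_iSup]
        refine iSup_le fun j => ?_
        rw [← mul_assoc]
        have hj := j.2
        refine le_trans (mul_le_mul_left (EGdeg_mul_le n H _ _) _) ?_
        have e1 : d - k + (k - j) = d - (j : ℕ) := by omega
        rw [e1]
        exact le_iSup (fun k : Fin (d + 1) => EGdeg n H (d - k) * C k) ⟨j, by omega⟩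
      · refine le_trans ?_ (le_iSup (fun k : Fin (d + 1) => EGdeg n H (d - k) * C k) (Fin.last d))
        intro c hc
        have h1 : (1 : E n) ∈ EGdeg n H (d - (Fin.last d : ℕ)) := by
          have := word_mem_EGdeg n H [] (by simp)
          simpa [word_nil] using this
        have := Submodule.mul_mem_mul h1 (show c ∈ C (Fin.last d : ℕ) by simpa using hc)
        simpa using this
  · refine iSup_le fun k => ?_
    refine (mul_le_mul' (EGdeg_mono n hHG _) (hC k)).trans ((EGdeg_mul_le n G _ _).trans ?_)
    rw [Nat.sub_add_cancel (by omega)]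

/-- The total multiplication map. -/
noncomputable def Phi (n : ℕ) (H : SimpleGraph (Fin n)) (C : ℕ → Submodule ℚ (E n)) (d : ℕ) :
    ((k : Fin (d + 1)) → ↥(EGdeg n H (d - k)) ⊗[ℚ] ↥(C k)) →ₗ[ℚ] E n :=
  ∑ k : Fin (d + 1), (mulBC n (EGdeg n H (d - k)) (C k)).comp (LinearMap.proj k)

theorem Phi_apply (n : ℕ) (H : SimpleGraph (Fin n)) (C : ℕ → Submodule ℚ (E n)) (d : ℕ)
    (t : (k : Fin (d + 1)) → ↥(EGdeg n H (d - k)) ⊗[ℚ] ↥(C k)) :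
    Phi n H C d t = ∑ k : Fin (d + 1), mulBC n (EGdeg n H (d - k)) (C k) (t k) := by
  simp [Phi]

theorem Phi_range (n : ℕ) (H : SimpleGraph (Fin n)) (C : ℕ → Submodule ℚ (E n)) (d : ℕ) :
    LinearMap.range (Phi n H C d) = ⨆ k : Fin (d + 1), EGdeg n H (d - k) * C k := by
  apply le_antisymm
  · rintro _ ⟨t, rfl⟩
    rw [Phi_apply]
    refine Submodule.sum_mem _ fun k _ => ?_
    refine Submodule.mem_iSup_of_mem k ?_
    rw [← mulBC_range]
    exact ⟨_, rfl⟩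
  · refine iSup_le fun k => ?_
    rw [← mulBC_range]
    rintro _ ⟨t, rfl⟩
    refine ⟨Pi.single k t, ?_⟩
    rw [Phi_apply, Finset.sum_eq_single k]
    · simp
    · intro j _ hj
      rw [Pi.single_eq_of_ne hj, map_zero]
    · simp

theorem Phi_injective (n : ℕ) {G H : SimpleGraph (Fin n)} (hHG : H ≤ G)
    (C : ℕ → Submodule ℚ (E n)) (P : ℕ → E n →ₗ[ℚ] E n)
    (hC : ∀ d, C d ≤ EGdeg n G d) (hP : ∀ d, ∀ a ∈ W n G H d, P d a = 0)
    (hP' : ∀ d, ∀ a ∈ C d, P d a = a) (d : ℕ) :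
    Function.Injective (Phi n H C d) := by
  let _ : ∀ k : Fin (d + 1), AddCommGroup (↥(EGdeg n H (d - k)) ⊗[ℚ] ↥(C k)) :=
    fun k => Module.addCommMonoidToAddCommGroup ℚ
  rw [injective_iff_map_eq_zero]
  intro t ht
  rw [Phi_apply] at ht
  by_contra hne
  classical
  have hS : (Finset.univ.filter fun k => t k ≠ 0).Nonempty := by
    by_contra h0
    rw [Finset.not_nonempty_iff_eq_empty, Finset.filter_eq_empty_iff] at h0
    apply hne
    funext k
    simpa using h0 (Finset.mem_univ k)
  obtain ⟨e, he, hmax⟩ := Finset.exists_max_image _ (fun k => k) hS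
  rw [Finset.mem_filter] at he
  apply he.2
  have h1 := congrArg (DD n e (P e)) ht
  rw [map_sum, map_zero, Finset.sum_eq_single e] at h1
  · rw [DD_mulBC n hHG e (P e) (hP e) _ e le_rfl (C e) (hC e)] at h1
    have e1 : ((P e).comp (proj n e)).comp (C e).subtype = (C e).subtype := by
      apply LinearMap.ext
      intro c
      simp only [LinearMap.comp_apply, Submodule.subtype_apply]
      rw [proj_degSpan n e _ (hC e c.2).2, hP' e _ c.2]
    rw [e1] at h1
    have := freeS n (C e)
    have := freeS n (EGdeg n H (d - e))
    have := freeS n ⊤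
    have hE : Module.Free ℚ (E n) := Module.Free.of_equiv (Submodule.topEquiv (R := ℚ) (M := E n))
    have inj := TensorProduct.map_injective_of_flat_flat (EGdeg n H (d - e)).subtype (C e).subtype
      (Submodule.subtype_injective _) (Submodule.subtype_injective _)
    exact inj (h1.trans (map_zero _).symm)
  · intro k _ hk
    by_cases h0 : t k = 0
    · rw [h0, map_zero, map_zero]
    · have hke : k ≤ e := hmax k (Finset.mem_filter.2 ⟨Finset.mem_univ _, h0⟩)
      rw [DD_mulBC n hHG e (P e) (hP e) _ k hke (C k) (hC k)]
      have e1 : ((P e).comp (proj n e)).comp (C k).subtype = 0 := by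
        apply LinearMap.ext
        intro c
        simp only [LinearMap.comp_apply, Submodule.subtype_apply, LinearMap.zero_apply]
        rw [proj_ne n G k e (fun h => hk (Fin.ext h)) _ (hC k c.2), map_zero]
      rw [e1, TensorProduct.map_zero_right, LinearMap.zero_apply]
  · simp

/-- if `H` is a subgraph of `G`, then the Hilbert series of `E_H` divides
that of `E_G` with nonnegative quotient: there are naturals `c₀, c₁, …` such that
`dim E_G^d = Σ_{k=0}^{d} c_k · dim E_H^{d-k}` for all `d`. -/
theorem stmt11 (n : ℕ) (hn : 1 ≤ n) (G H : SimpleGraph (Fin n)) (hHG : H ≤ G) :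
    ∃ c : ℕ → ℕ, ∀ d : ℕ,
      Module.finrank ℚ ↥(EGdeg n G d) =
        ∑ k ∈ Finset.range (d + 1), c k * Module.finrank ℚ ↥(EGdeg n H (d - k)) := by
  choose C P hC hC' hP hP' using fun d => exists_C n hHG d
  refine ⟨fun k => Module.finrank ℚ ↥(C k), fun d => ?_⟩
  have hfin : ∀ k, Module.Finite ℚ ↥(C k) := fun k =>
    Submodule.finiteDimensional_of_le (hC k)
  have hfree : ∀ k : Fin (d + 1), Module.Free ℚ (↥(EGdeg n H (d - k)) ⊗[ℚ] ↥(C k)) := by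
    intro k
    let _ : AddCommGroup (↥(EGdeg n H (d - k)) ⊗[ℚ] ↥(C k)) := Module.addCommMonoidToAddCommGroup ℚ
    exact Module.Free.of_divisionRing _ _
  rw [decomp n hHG C hC hC' d, ← Phi_range,
    LinearMap.finrank_range_of_inj (Phi_injective n hHG C P hC hP hP' d),
    Module.finrank_pi_fintype, Finset.sum_range]
  refine Finset.sum_congr rfl fun k _ => ?_
  have := freeS n (C k)
  have := freeS n (EGdeg n H (d - k))
  rw [Module.finrank_tensorProduct, mul_comm]

end FK
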